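/- Let G be a groupoid and let R be a G-graded ring; simultaneously regard R as S(G)-graded, where S(G) = G ∪ {0_S} is the inverse semigroup associated with G and R_{0_S} = {0}. Then R is epsilon-strongly G-graded (resp. nearly epsilon-strongly G-graded) if and only if R is epsilon-strongly S(G)-graded (resp. nearly epsilon-strongly S(G)-graded). -/

import Mathlib

open scoped Pointwise
open CategoryTheory

/-! ### Semigroup graded rings -/

/-- The set `V(s) = {t ∈ S ∣ sts = s and tst = t}`. -/
def invSet {S : Type*} [Semigroup S] (s : S) : Set S :=
  {t | s * t * s = s ∧ t * s * t = t}

/-- The product `A B` of two additive subgroups of a ring: the additive subgroup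
generated by all products `a * b` with `a ∈ A`, `b ∈ B`. -/
def subgroupMul {R : Type*} [NonUnitalRing R] (A B : AddSubgroup R) : AddSubgroup R :=
  AddSubgroup.closure ((A : Set R) * (B : Set R))

/-- A subset `P` of `R` (closed under multiplication) is a unital ring:
it has a two-sided multiplicative identity element. -/
def HasUnity {R : Type*} [NonUnitalRing R] (P : AddSubgroup R) : Prop :=
  ∃ u ∈ P, ∀ x ∈ P, u * x = x ∧ x * u = x

/-- A subset `P` of `R` is an s-unital ring: `x ∈ Px` and `x ∈ xP` for every `x ∈ P`. -/
def IsSUnital {R : Type*} [NonUnitalRing R] (P : AddSubgroup R) : Prop :=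
  ∀ x ∈ P, (∃ u ∈ P, u * x = x) ∧ (∃ v ∈ P, x * v = x)

/-- `R` is symmetrically `S`-graded: `R_s = R_s R_t R_s` for all `s ∈ S`, `t ∈ V(s)`. -/
def SymmetricallyGraded {S R : Type*} [Semigroup S] [NonUnitalRing R]
    (𝒜 : S → AddSubgroup R) : Prop :=
  ∀ s : S, ∀ t ∈ invSet s, 𝒜 s = subgroupMul (subgroupMul (𝒜 s) (𝒜 t)) (𝒜 s)

/-- `R` is epsilon-strongly `S`-graded. -/
def EpsilonStronglyGraded {S R : Type*} [Semigroup S] [NonUnitalRing R]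
    (𝒜 : S → AddSubgroup R) : Prop :=
  SymmetricallyGraded 𝒜 ∧ ∀ s : S, ∀ t ∈ invSet s, HasUnity (subgroupMul (𝒜 s) (𝒜 t))

/-- `R` is nearly epsilon-strongly `S`-graded. -/
def NearlyEpsilonStronglyGraded {S R : Type*} [Semigroup S] [NonUnitalRing R]
    (𝒜 : S → AddSubgroup R) : Prop :=
  SymmetricallyGraded 𝒜 ∧ ∀ s : S, ∀ t ∈ invSet s, IsSUnital (subgroupMul (𝒜 s) (𝒜 t))

/-! ### Groupoid graded rings -/

/-- The set of morphisms of a groupoid `G` (with object type `Ob`), encoded as triples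
`⟨a, b, g⟩` where `g : a ⟶ b`; thus `d(⟨a,b,g⟩) = a` and `c(⟨a,b,g⟩) = b`. -/
abbrev GroupoidMor (Ob : Type*) [Groupoid Ob] : Type _ := Σ a b : Ob, a ⟶ b

/-- The inverse morphism: if `g : a ⟶ b` then `g⁻¹ : b ⟶ a`. -/
def GroupoidMor.inv {Ob : Type*} [Groupoid Ob] (g : GroupoidMor Ob) : GroupoidMor Ob :=
  ⟨g.2.1, g.1, Groupoid.inv g.2.2⟩

/-- `R` is a `G`-graded ring via the family `𝒜` of additive subgroups indexed by the
morphisms of the groupoid `G`: `R = ⊕_{g ∈ G} R_g` (internal direct sum),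
`R_g R_h ⊆ R_{gh}` for composable pairs `(g,h)` (i.e. `d(g) = c(h)`), and
`R_g R_h = {0}` for non-composable pairs. -/
structure IsGroupoidGrading {Ob R : Type*} [Groupoid Ob] [DecidableEq (GroupoidMor Ob)]
    [NonUnitalRing R] (𝒜 : GroupoidMor Ob → AddSubgroup R) : Prop where
  internal : DirectSum.IsInternal 𝒜
  mul_mem : ∀ (a b c : Ob) (g : b ⟶ c) (h : a ⟶ b),
    ∀ x ∈ 𝒜 ⟨b, c, g⟩, ∀ y ∈ 𝒜 ⟨a, b, h⟩, x * y ∈ 𝒜 ⟨a, c, h ≫ g⟩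
  mul_eq_zero : ∀ g h : GroupoidMor Ob, g.1 ≠ h.2.1 →
    ∀ x ∈ 𝒜 g, ∀ y ∈ 𝒜 h, x * y = 0

/-- `R` is symmetrically `G`-graded: `R_g = R_g R_{g⁻¹} R_g` for every morphism `g`. -/
def SymmetricallyGroupoidGraded {Ob R : Type*} [Groupoid Ob] [NonUnitalRing R]
    (𝒜 : GroupoidMor Ob → AddSubgroup R) : Prop :=
  ∀ g : GroupoidMor Ob, 𝒜 g = subgroupMul (subgroupMul (𝒜 g) (𝒜 g.inv)) (𝒜 g)

/-- `R` is epsilon-strongly `G`-graded: symmetrically `G`-graded and `R_g R_{g⁻¹}`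
is unital for every morphism `g`. -/
def EpsilonStronglyGroupoidGraded {Ob R : Type*} [Groupoid Ob] [NonUnitalRing R]
    (𝒜 : GroupoidMor Ob → AddSubgroup R) : Prop :=
  SymmetricallyGroupoidGraded 𝒜 ∧
    ∀ g : GroupoidMor Ob, HasUnity (subgroupMul (𝒜 g) (𝒜 g.inv))

/-- `R` is nearly epsilon-strongly `G`-graded: symmetrically `G`-graded and
`R_g R_{g⁻¹}` is s-unital for every morphism `g`. -/
def NearlyEpsilonStronglyGroupoidGraded {Ob R : Type*} [Groupoid Ob] [NonUnitalRing R]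
    (𝒜 : GroupoidMor Ob → AddSubgroup R) : Prop :=
  SymmetricallyGroupoidGraded 𝒜 ∧
    ∀ g : GroupoidMor Ob, IsSUnital (subgroupMul (𝒜 g) (𝒜 g.inv))

/-! ### The inverse semigroup `S(G)` associated with a groupoid `G` -/

/-- `S(G) = G ∪ {0_S}`: `none` is the adjoined zero element `0_S` and `some g`
represents the morphism `g` of `G`. -/
abbrev GroupoidSemigroup (Ob : Type*) [Groupoid Ob] : Type _ := Option (GroupoidMor Ob)

namespace GroupoidSemigroup

variable {Ob : Type*} [Groupoid Ob] [DecidableEq Ob]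

/-- The binary operation on `S(G)`: `g * h = gh` if `(g,h)` is composable
(`d(g) = c(h)`), `g * h = 0_S` otherwise, and `0_S` is absorbing. -/
instance : Mul (GroupoidSemigroup Ob) :=
  ⟨fun x y =>
    match x, y with
    | some ⟨a₁, b₁, f₁⟩, some ⟨a₂, b₂, f₂⟩ =>
        if h : a₁ = b₂ then some ⟨a₂, b₁, f₂ ≫ eqToHom h.symm ≫ f₁⟩ else none
    | _, _ => none⟩

theorem some_mul_some (a₁ b₁ a₂ b₂ : Ob) (f₁ : a₁ ⟶ b₁) (f₂ : a₂ ⟶ b₂) :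
    (some ⟨a₁, b₁, f₁⟩ : GroupoidSemigroup Ob) * some ⟨a₂, b₂, f₂⟩ =
      if h : a₁ = b₂ then some ⟨a₂, b₁, f₂ ≫ eqToHom h.symm ≫ f₁⟩ else none := rfl

theorem none_mul (x : GroupoidSemigroup Ob) : (none : GroupoidSemigroup Ob) * x = none := by
  cases x <;> rfl

theorem mul_none (x : GroupoidSemigroup Ob) : x * (none : GroupoidSemigroup Ob) = none := by
  rcases x with _ | ⟨a, b, f⟩ <;> rfl

instance : Semigroup (GroupoidSemigroup Ob) where
  mul_assoc x y z := by
    rcases x with _ | ⟨a₁, b₁, f₁⟩ <;> rcases y with _ | ⟨a₂, b₂, f₂⟩ <;>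
      rcases z with _ | ⟨a₃, b₃, f₃⟩ <;>
      simp only [none_mul, mul_none, some_mul_some]
    rcases eq_or_ne a₁ b₂ with h1 | h1 <;> rcases eq_or_ne a₂ b₃ with h2 | h2
    · subst h1; subst h2
      simp [some_mul_some]
    · subst h1
      simp [some_mul_some, h2, none_mul, mul_none]
    · subst h2
      simp [some_mul_some, h1, none_mul, mul_none]
    · simp [some_mul_some, h1, h2, none_mul, mul_none]

end GroupoidSemigroup

/-- A `G`-graded ring becomes `S(G)`-graded by keeping the components `R_g` for
`g ∈ G` and setting `R_{0_S} = {0}`. -/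
def extendGrading {Ob R : Type*} [Groupoid Ob] [NonUnitalRing R]
    (𝒜 : GroupoidMor Ob → AddSubgroup R) : GroupoidSemigroup Ob → AddSubgroup R :=
  fun x =>
    match x with
    | none => ⊥
    | some g => 𝒜 g

namespace GroupoidSemigroup

variable {Ob : Type*} [Groupoid Ob] [DecidableEq Ob]

theorem mem_invSet_none {t : GroupoidSemigroup Ob} :
    t ∈ invSet (none : GroupoidSemigroup Ob) ↔ t = none := by
  constructor
  · rintro ⟨-, h⟩
    rw [mul_none, none_mul] at h
    exact h.symm
  · rintro rfl
    exact ⟨rfl, rfl⟩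

theorem mem_invSet_some {g : GroupoidMor Ob} {t : GroupoidSemigroup Ob} :
    t ∈ invSet (some g : GroupoidSemigroup Ob) ↔ t = some g.inv := by
  obtain ⟨a, b, f⟩ := g
  constructor
  · rintro ⟨h, -⟩
    rcases t with _ | ⟨c, d, k⟩
    · simp [mul_none, none_mul] at h
    · by_cases had : a = d
      · subst had
        by_cases hcb : c = b
        · subst hcb
          simp only [some_mul_some, dite_true, eqToHom_refl, Category.id_comp, Option.some.injEq,
            Sigma.mk.injEq, heq_eq_eq, true_and] at h
          have hk : f ≫ k = 𝟙 a := by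
            rw [← cancel_mono f, Category.assoc, h, Category.id_comp]
          have : k = Groupoid.inv f := by
            rw [← cancel_epi f, hk, Groupoid.comp_inv]
          rw [this]
          rfl
        · simp [some_mul_some, hcb] at h
      · simp [some_mul_some, had, none_mul] at h
  · rintro rfl
    constructor <;> simp [GroupoidMor.inv, some_mul_some]

/-- A property of pairs `(s, t)` with `t ∈ V(s)` holds on `S(G)` as soon as it holds at zero
and at the pairs `(g, g⁻¹)`. -/
theorem forall_mem_invSet_iff {P : GroupoidSemigroup Ob → GroupoidSemigroup Ob → Prop}
    (h0 : P none none) :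
    (∀ s, ∀ t ∈ invSet s, P s t) ↔ ∀ g : GroupoidMor Ob, P (some g) (some g.inv) := by
  constructor
  · exact fun h g => h _ _ (mem_invSet_some.2 rfl)
  · rintro h (_ | g) t ht
    · rwa [mem_invSet_none.1 ht]
    · rw [mem_invSet_some.1 ht]
      exact h g

end GroupoidSemigroup

theorem subgroupMul_bot {R : Type*} [NonUnitalRing R] (A : AddSubgroup R) :
    subgroupMul A ⊥ = ⊥ := by
  rw [subgroupMul, AddSubgroup.closure_eq_bot_iff]
  rintro _ ⟨x, -, y, hy, rfl⟩
  rw [SetLike.mem_coe, AddSubgroup.mem_bot] at hy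
  simp [hy]

theorem hasUnity_bot {R : Type*} [NonUnitalRing R] : HasUnity (⊥ : AddSubgroup R) :=
  ⟨0, zero_mem _, by simp⟩

theorem isSUnital_bot {R : Type*} [NonUnitalRing R] : IsSUnital (⊥ : AddSubgroup R) := by
  intro x hx
  rw [AddSubgroup.mem_bot] at hx
  exact ⟨⟨0, zero_mem _, by simp [hx]⟩, ⟨0, zero_mem _, by simp [hx]⟩⟩

theorem symmetricallyGraded_extendGrading_iff {Ob R : Type*} [Groupoid Ob] [DecidableEq Ob]
    [NonUnitalRing R] (𝒜 : GroupoidMor Ob → AddSubgroup R) :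
    SymmetricallyGraded (extendGrading 𝒜) ↔ SymmetricallyGroupoidGraded 𝒜 :=
  GroupoidSemigroup.forall_mem_invSet_iff (subgroupMul_bot _).symm

theorem forall_invSet_extendGrading_iff {Ob R : Type*} [Groupoid Ob] [DecidableEq Ob]
    [NonUnitalRing R] (𝒜 : GroupoidMor Ob → AddSubgroup R) {Q : AddSubgroup R → Prop}
    (hQ : Q ⊥) :
    (∀ s : GroupoidSemigroup Ob, ∀ t ∈ invSet s,
        Q (subgroupMul (extendGrading 𝒜 s) (extendGrading 𝒜 t))) ↔
      ∀ g : GroupoidMor Ob, Q (subgroupMul (𝒜 g) (𝒜 g.inv)) :=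
  GroupoidSemigroup.forall_mem_invSet_iff
    (P := fun s t => Q (subgroupMul (extendGrading 𝒜 s) (extendGrading 𝒜 t)))
    ((subgroupMul_bot (⊥ : AddSubgroup R)).symm ▸ hQ)

/-- **Proposition.** Let `G` be a groupoid and `R` a `G`-graded ring; simultaneously
regard `R` as `S(G)`-graded, where `S(G) = G ∪ {0_S}` is the inverse semigroup
associated with `G` and `R_{0_S} = {0}`. Then `R` is epsilon-strongly `G`-graded
(resp. nearly epsilon-strongly `G`-graded) if and only if `R` is epsilon-strongly
`S(G)`-graded (resp. nearly epsilon-strongly `S(G)`-graded). -/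
theorem epsilonStrong_groupoid_iff_semigroup
    {Ob R : Type*} [Groupoid Ob] [DecidableEq Ob] [DecidableEq (GroupoidMor Ob)]
    [NonUnitalRing R]
    (𝒜 : GroupoidMor Ob → AddSubgroup R) (hgr : IsGroupoidGrading 𝒜) :
    (EpsilonStronglyGroupoidGraded 𝒜 ↔ EpsilonStronglyGraded (extendGrading 𝒜)) ∧
    (NearlyEpsilonStronglyGroupoidGraded 𝒜 ↔
      NearlyEpsilonStronglyGraded (extendGrading 𝒜)) :=
  ⟨(and_congr (symmetricallyGraded_extendGrading_iff 𝒜)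
      (forall_invSet_extendGrading_iff 𝒜 hasUnity_bot)).symm,
    (and_congr (symmetricallyGraded_extendGrading_iff 𝒜)
      (forall_invSet_extendGrading_iff 𝒜 isSUnital_bot)).symm⟩
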